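/- arXiv:2210.07513 — 6 statements merged into one kernel-verified Lean document; each statement's English description precedes it below -/
import Mathlib

section
/- Let (α_n) be a sequence of real numbers, let (β_n), (σ_n), (f_n) be sequences of positive real numbers, and let α̂, β̂, σ̂ be real numbers with σ_n² α_n/(f_n β_n²) → α̂, σ_n²/(β_n² n) → β̂, and √n · σ_n/f_n → σ̂ as n → ∞. Fix ŝ ∈ ℝ and q̂ > 0, and let μ̄_n = (α_n β_n^{−2} + f_n ŝ σ_n^{−2})/(n q̂ σ_n^{−2} + β_n^{−2}). Then (n/f_n²) · ( σ_n² + 1/(n q̂ σ_n^{−2} + β_n^{−2}) + μ̄_n² ) → σ̂². -/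
open Filter Topology

theorem normal_rescaled_second_moment_limit (α : ℕ → ℝ) (β σ f : ℕ → ℝ)
    (hβ : ∀ n, 0 < β n) (hσ : ∀ n, 0 < σ n) (hf : ∀ n, 0 < f n)
    (αh βh σh : ℝ)
    (h1 : Tendsto (fun n : ℕ => (σ n) ^ 2 * α n / (f n * (β n) ^ 2)) atTop (𝓝 αh))
    (h2 : Tendsto (fun n : ℕ => (σ n) ^ 2 / ((β n) ^ 2 * (n : ℝ))) atTop (𝓝 βh))
    (h3 : Tendsto (fun n : ℕ => Real.sqrt n * σ n / f n) atTop (𝓝 σh))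
    (sh qh : ℝ) (hq : 0 < qh)
    (μbar : ℕ → ℝ)
    (hμbar : ∀ n : ℕ, μbar n = (α n * (β n) ^ (-2 : ℤ) + f n * sh * (σ n) ^ (-2 : ℤ)) /
      ((n : ℝ) * qh * (σ n) ^ (-2 : ℤ) + (β n) ^ (-2 : ℤ))) :
    Tendsto (fun n : ℕ => ((n : ℝ) / (f n) ^ 2) *
        ((σ n) ^ 2 + 1 / ((n : ℝ) * qh * (σ n) ^ (-2 : ℤ) + (β n) ^ (-2 : ℤ)) + (μbar n) ^ 2))
      atTop (𝓝 (σh ^ 2)) := by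
  have hb : 0 ≤ βh := ge_of_tendsto' h2 (fun n => by have := hβ n; positivity)
  have hne : qh + βh ≠ 0 := by positivity
  have hB := (h2.const_add qh).inv₀ hne
  have hN : Tendsto (fun n : ℕ => ((n : ℝ))⁻¹) atTop (𝓝 0) := tendsto_inv_atTop_nhds_zero_nat
  have key := ((h3.pow 2).add (((h3.pow 2).mul hB).mul hN)).add
    ((((h1.add_const sh).mul hB).pow 2).mul hN)
  rw [mul_zero, mul_zero, add_zero, add_zero] at key
  refine key.congr' ?_
  filter_upwards [eventually_gt_atTop 0] with n hn
  have hn' : (0 : ℝ) < n := by exact_mod_cast hn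
  have b := hβ n
  have c := hσ n
  have d := hf n
  have hz : ∀ x : ℝ, x ^ (-2 : ℤ) = (x ^ 2)⁻¹ := fun x => by
    rw [zpow_neg]; norm_cast
  have hD : (n : ℝ) * qh * ((σ n) ^ 2)⁻¹ + ((β n) ^ 2)⁻¹
      = n / (σ n) ^ 2 * (qh + (σ n) ^ 2 / ((β n) ^ 2 * (n : ℝ))) := by
    field_simp
  have hM : α n * ((β n) ^ 2)⁻¹ + f n * sh * ((σ n) ^ 2)⁻¹
      = f n / (σ n) ^ 2 * ((σ n) ^ 2 * α n / (f n * (β n) ^ 2) + sh) := by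
    field_simp
  have hE : 0 < qh + (σ n) ^ 2 / ((β n) ^ 2 * (n : ℝ)) := by positivity
  have hs : (Real.sqrt n * σ n / f n) ^ 2 = n * (σ n) ^ 2 / (f n) ^ 2 := by
    rw [div_pow, mul_pow, Real.sq_sqrt hn'.le]
  rw [hμbar, hz, hz, hD, hM, hs]
  generalize qh + (σ n) ^ 2 / ((β n) ^ 2 * (n : ℝ)) = E at *
  generalize (σ n) ^ 2 * α n / (f n * (β n) ^ 2) + sh = M at *
  field_simp
end

section
/- Fix vectors a₁, …, a_K ∈ ℝ^d, a vector q̂ ∈ ℝ^K with nonnegative entries, and ŝ ∈ ℝ^K. Let (Σ_n) be a sequence of positive definite real d×d matrices, (α_n) ⊂ ℝ^d, and (σ_n), (f_n) positive sequences, such that (σ_n²/n) Σ_n^{−1} → S and (σ_n²/f_n) Σ_n^{−1} α_n → α̂ as n → ∞, for some d×d matrix S and vector α̂ ∈ ℝ^d, and suppose the matrix M = S + Σ_{j=1}^K q̂_j a_j a_jᵀ is invertible. Then for each k ∈ {1, …, K}: (n/f_n) · a_kᵀ (Σ_n^{−1} + σ_n^{−2} Σ_{j=1}^K n q̂_j a_j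 a_jᵀ)^{−1} (Σ_n^{−1} α_n + σ_n^{−2} Σ_{j=1}^K f_n ŝ_j a_j) → a_kᵀ M^{−1} (α̂ + Σ_{j=1}^K ŝ_j a_j). -/
open Matrix Filter Topology

theorem linear_bandit_rescaled_drift_limit (d K : ℕ)
    (a : Fin K → Fin d → ℝ) (qh : Fin K → ℝ) (hqh : ∀ j, 0 ≤ qh j) (sh : Fin K → ℝ)
    (Sn : ℕ → Matrix (Fin d) (Fin d) ℝ) (hSn : ∀ n, (Sn n).PosDef)
    (α : ℕ → Fin d → ℝ) (σ f : ℕ → ℝ) (hσ : ∀ n, 0 < σ n) (hf : ∀ n, 0 < f n)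
    (S : Matrix (Fin d) (Fin d) ℝ) (αh : Fin d → ℝ)
    (h1 : Tendsto (fun n : ℕ => ((σ n) ^ 2 / (n : ℝ)) • (Sn n)⁻¹) atTop (𝓝 S))
    (h2 : Tendsto (fun n : ℕ => ((σ n) ^ 2 / f n) • ((Sn n)⁻¹ *ᵥ α n)) atTop (𝓝 αh))
    (M : Matrix (Fin d) (Fin d) ℝ)
    (hM : M = S + ∑ j, qh j • vecMulVec (a j) (a j))
    (hMinv : IsUnit M.det) :
    ∀ k : Fin K,
      Tendsto (fun n : ℕ => ((n : ℝ) / f n) *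
          (a k ⬝ᵥ (((Sn n)⁻¹ +
              (σ n) ^ (-2 : ℤ) • ∑ j, ((n : ℝ) * qh j) • vecMulVec (a j) (a j))⁻¹ *ᵥ
            ((Sn n)⁻¹ *ᵥ α n + (σ n) ^ (-2 : ℤ) • ∑ j, (f n * sh j) • a j))))
        atTop (𝓝 (a k ⬝ᵥ (M⁻¹ *ᵥ (αh + ∑ j, sh j • a j)))) := by
  intro k
  set Q : Matrix (Fin d) (Fin d) ℝ := ∑ j, qh j • vecMulVec (a j) (a j) with hQ
  set b : Fin d → ℝ := ∑ j, sh j • a j with hb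
  have hB : Tendsto (fun n : ℕ => ((σ n) ^ 2 / (n : ℝ)) • (Sn n)⁻¹ + Q) atTop (𝓝 M) := by
    rw [hM]; exact h1.add_const Q
  have hu : Tendsto (fun n : ℕ => ((σ n) ^ 2 / f n) • ((Sn n)⁻¹ *ᵥ α n) + b) atTop
      (𝓝 (αh + b)) := h2.add_const b
  have hM0 : M.det ≠ 0 := hMinv.ne_zero
  have hdc : Continuous (fun A : Matrix (Fin d) (Fin d) ℝ => A.det) :=
    Continuous.matrix_det continuous_id
  have hac : Continuous (fun A : Matrix (Fin d) (Fin d) ℝ => A.adjugate) :=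
    Continuous.matrix_adjugate continuous_id
  have hdet := (hdc.tendsto M).comp hB
  have hne := hdet.eventually_ne hM0
  have hinv : Tendsto (fun n : ℕ => (((σ n) ^ 2 / (n : ℝ)) • (Sn n)⁻¹ + Q)⁻¹) atTop
      (𝓝 M⁻¹) := by
    simp only [Matrix.inv_def, Ring.inverse_eq_inv]
    simp only [Matrix.inv_def, Ring.inverse_eq_inv] at hB hdet
    exact (hdet.inv₀ hM0).smul ((hac.tendsto M).comp hB)
  have hc : Continuous (fun p : Matrix (Fin d) (Fin d) ℝ × (Fin d → ℝ) =>
      a k ⬝ᵥ (p.1 *ᵥ p.2)) :=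
    Continuous.dotProduct continuous_const (Continuous.matrix_mulVec continuous_fst continuous_snd)
  have hlim := (hc.tendsto (M⁻¹, αh + b)).comp (hinv.prodMk_nhds hu)
  refine hlim.congr' ?_
  filter_upwards [hne, eventually_gt_atTop 0] with n hn hn0
  have hnr : (n : ℝ) ≠ 0 := by exact_mod_cast hn0.ne'
  have hn' : IsUnit (((σ n) ^ 2 / (n : ℝ)) • (Sn n)⁻¹ + Q).det := isUnit_iff_ne_zero.mpr hn
  have hs := (hσ n).ne'
  have hfn := (hf n).ne'
  have hz : (σ n) ^ (-2 : ℤ) = ((σ n) ^ 2)⁻¹ := by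
    rw [_root_.zpow_neg]; norm_cast
  have hsum : ∑ j, ((n : ℝ) * qh j) • vecMulVec (a j) (a j) = (n : ℝ) • Q := by
    rw [hQ, Finset.smul_sum]; simp only [mul_smul]
  have hsum2 : ∑ j, (f n * sh j) • a j = f n • b := by
    rw [hb, Finset.smul_sum]; simp only [mul_smul]
  have hk : (n : ℝ) / (σ n) ^ 2 ≠ 0 := by positivity
  have hA : (Sn n)⁻¹ + ((σ n) ^ 2)⁻¹ • (n : ℝ) • Q
      = ((n : ℝ) / (σ n) ^ 2) • (((σ n) ^ 2 / (n : ℝ)) • (Sn n)⁻¹ + Q) := by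
    rw [smul_add, smul_smul, smul_smul]
    congr 1
    · rw [show (n : ℝ) / (σ n) ^ 2 * ((σ n) ^ 2 / n) = 1 by field_simp, one_smul]
    · congr 1; field_simp
  have hw : (Sn n)⁻¹ *ᵥ α n + ((σ n) ^ 2)⁻¹ • f n • b
      = (f n / (σ n) ^ 2) • (((σ n) ^ 2 / f n) • ((Sn n)⁻¹ *ᵥ α n) + b) := by
    rw [smul_add, smul_smul, smul_smul]
    congr 1
    · rw [show f n / (σ n) ^ 2 * ((σ n) ^ 2 / f n) = 1 by field_simp, one_smul]
    · congr 1; field_simp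
  have hI : (((n : ℝ) / (σ n) ^ 2) • (((σ n) ^ 2 / (n : ℝ)) • (Sn n)⁻¹ + Q))⁻¹
      = ((n : ℝ) / (σ n) ^ 2)⁻¹ • (((σ n) ^ 2 / (n : ℝ)) • (Sn n)⁻¹ + Q)⁻¹ := by
    have := invertibleOfNonzero hk
    rw [Matrix.inv_smul _ _ hn', invOf_eq_inv]
  rw [hz, hsum, hsum2, hA, hw, hI,
    Matrix.smul_mulVec, Matrix.mulVec_smul,
    dotProduct_smul, dotProduct_smul, smul_eq_mul, smul_eq_mul]
  simp only [Function.comp]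
  field_simp
end

section
/- Let K ≥ 1, let α₁, …, α_K, β₁, …, β_K ∈ ℝ, and let t₀ ∈ [0, 1). Let π : [t₀, 1] → ℝ^K be an integrable control with π_k(τ) ≥ 0 and Σ_k π_k(τ) = 1 for all τ, and let s_k, q_k : [t₀, 1] → ℝ be differentiable with q_k(τ) + β_k > 0, q_k'(τ) = π_k(τ), and s_k'(τ) = μ_k(τ) π_k(τ) for all τ, where μ_k(τ) = (s_k(τ) + α_k)/(q_k(τ) + β_k). Then the payoff ∫_{t₀}^1 Σ_{k=1}^K μ_k(τ) π_k(τ) dτ is at most (1 − t₀) · max_{1≤k≤K} μ_k(t₀); moreover, if k* attains max_k μ_k(t₀) and π is constantly equal to the k*-th standard basis vector, then the payoff equals (1 − t₀) · max_k μ_k(t₀). -/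
open MeasureTheory

theorem unregularized_exact_optimal_value (K : ℕ) (hK : 0 < K)
    (α β : Fin K → ℝ) (t₀ : ℝ) (ht₀ : 0 ≤ t₀) (ht₁ : t₀ < 1)
    (π : ℝ → Fin K → ℝ) (s q : ℝ → Fin K → ℝ)
    (hπint : ∀ k, IntervalIntegrable (fun τ => π τ k) volume t₀ 1)
    (hπ0 : ∀ τ ∈ Set.Icc t₀ 1, ∀ k, 0 ≤ π τ k)
    (hπ1 : ∀ τ ∈ Set.Icc t₀ 1, ∑ k, π τ k = 1)
    (hqβ : ∀ τ ∈ Set.Icc t₀ 1, ∀ k, 0 < q τ k + β k)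
    (hq : ∀ k, ∀ τ ∈ Set.Icc t₀ 1, HasDerivAt (fun t => q t k) (π τ k) τ)
    (hs : ∀ k, ∀ τ ∈ Set.Icc t₀ 1,
      HasDerivAt (fun t => s t k) ((s τ k + α k) / (q τ k + β k) * π τ k) τ) :
    ((∫ τ in t₀..1, ∑ k, (s τ k + α k) / (q τ k + β k) * π τ k) ≤
      (1 - t₀) * Finset.univ.sup' (Finset.univ_nonempty_iff.mpr ⟨⟨0, hK⟩⟩)
        (fun k => (s t₀ k + α k) / (q t₀ k + β k))) ∧
    ∀ kstar : Fin K,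
      ((s t₀ kstar + α kstar) / (q t₀ kstar + β kstar) =
        Finset.univ.sup' (Finset.univ_nonempty_iff.mpr ⟨⟨0, hK⟩⟩)
          (fun k => (s t₀ k + α k) / (q t₀ k + β k))) →
      (∀ τ ∈ Set.Icc t₀ 1, π τ = fun k => if k = kstar then 1 else 0) →
      (∫ τ in t₀..1, ∑ k, (s τ k + α k) / (q τ k + β k) * π τ k) =
        (1 - t₀) * Finset.univ.sup' (Finset.univ_nonempty_iff.mpr ⟨⟨0, hK⟩⟩)
          (fun k => (s t₀ k + α k) / (q t₀ k + β k)) := by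
  have hconst : ∀ k, ∀ τ ∈ Set.Icc t₀ 1,
      (s τ k + α k) / (q τ k + β k) = (s t₀ k + α k) / (q t₀ k + β k) := by
    intro k
    have hd : ∀ τ ∈ Set.Icc t₀ 1,
        HasDerivAt (fun t => (s t k + α k) / (q t k + β k)) 0 τ := by
      intro τ hτ
      have hne := (hqβ τ hτ k).ne'
      have h := ((hs k τ hτ).add_const (α k)).div ((hq k τ hτ).add_const (β k)) hne
      refine h.congr_deriv ?_
      field_simp
      ring
    exact constant_of_has_deriv_right_zero
      (f := fun t => (s t k + α k) / (q t k + β k))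
      (fun τ hτ => (hd τ hτ).continuousAt.continuousWithinAt)
      (fun τ hτ => (hd τ (Set.Ico_subset_Icc_self hτ)).hasDerivWithinAt)
  have hint : (∫ τ in t₀..1, ∑ k, (s τ k + α k) / (q τ k + β k) * π τ k) =
      ∫ τ in t₀..1, ∑ k, (s t₀ k + α k) / (q t₀ k + β k) * π τ k := by
    apply intervalIntegral.integral_congr
    intro τ hτ
    rw [Set.uIcc_of_le ht₁.le] at hτ
    exact Finset.sum_congr rfl fun k _ => by rw [hconst k τ hτ]
  rw [hint]
  constructor
  · have hc : (1 - t₀) * Finset.univ.sup' (Finset.univ_nonempty_iff.mpr ⟨⟨0, hK⟩⟩)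
        (fun k => (s t₀ k + α k) / (q t₀ k + β k)) =
        ∫ _τ in t₀..1, Finset.univ.sup' (Finset.univ_nonempty_iff.mpr ⟨⟨0, hK⟩⟩)
        (fun k => (s t₀ k + α k) / (q t₀ k + β k)) := by
      rw [intervalIntegral.integral_const, smul_eq_mul]
    rw [hc]
    apply intervalIntegral.integral_mono_on ht₁.le
    · have := IntervalIntegrable.sum (μ := volume) (a := t₀) (b := 1) Finset.univ
        (f := fun k τ => (s t₀ k + α k) / (q t₀ k + β k) * π τ k)
        (fun k _ => (hπint k).const_mul _)
      have he : (fun τ => ∑ k, (s t₀ k + α k) / (q t₀ k + β k) * π τ k) =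
          ∑ k, fun τ => (s t₀ k + α k) / (q t₀ k + β k) * π τ k := by
        ext τ
        simp
      rw [he]
      exact this
    · exact intervalIntegrable_const
    · intro τ hτ
      calc _ ≤ ∑ k, Finset.univ.sup' (Finset.univ_nonempty_iff.mpr ⟨⟨0, hK⟩⟩)
            (fun k => (s t₀ k + α k) / (q t₀ k + β k)) * π τ k := by
            refine Finset.sum_le_sum fun k _ => mul_le_mul_of_nonneg_right ?_ (hπ0 τ hτ k)
            exact Finset.le_sup' (fun k => (s t₀ k + α k) / (q t₀ k + β k)) (Finset.mem_univ k)
        _ = _ := by rw [← Finset.mul_sum, hπ1 τ hτ, mul_one]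
  · intro kstar hk hπ
    rw [← hk, ← smul_eq_mul, ← intervalIntegral.integral_const]
    apply intervalIntegral.integral_congr
    intro τ hτ
    rw [Set.uIcc_of_le ht₁.le] at hτ
    simp [hπ τ hτ]
end

section
/- Let K ≥ 1, let λ > 0, let α₁, …, α_K, β₁, …, β_K ∈ ℝ, and let t₀ ∈ [0, 1). Let π : [t₀, 1] → ℝ^K be an integrable control with π_k(τ) ≥ 0 and Σ_k π_k(τ) = 1 for all τ (with the convention π_k log π_k = 0 when π_k = 0), and let s_k, q_k : [t₀, 1] → ℝ be differentiable with q_k(τ) + β_k > 0, q_k'(τ) = π_k(τ), and s_k'(τ) = μ_k(τ) π_k(τ) for all τ, where μ_k(τ) = (s_k(τ) + α_k)/(q_k(τ) + β_k). Then the regularized payoff ∫_{t₀}^1 Σ_{k=1}^K (μ_k(τ) − λ log π_k(τ)) π_k(τ) dτ is at most (1 − t₀) · λ log( Σ_{k=1}^K exp(μ_k(t₀)/λ) ); moreover, the constant softmax control π_k(τ) = exp(μ_k(t₀)/λ)/Σ_j exp(μ_j(t₀)/λ) satisfies the dynamics constraints for suitable trajectories and achieves this bound with equality. -/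
open MeasureTheory

lemma aux_gibbs (lam Z m p : ℝ) (hlam : 0 < lam) (hZ : 0 < Z) (hp : 0 ≤ p) :
    (m - lam * Real.log p) * p ≤
      lam * (Real.exp (m / lam) / Z - p) + lam * Real.log Z * p := by
  rcases hp.eq_or_lt with rfl | hp
  · simp only [mul_zero, sub_zero, add_zero]
    positivity
  · have hw : 0 < Real.exp (m / lam) / Z := by positivity
    have h := Real.log_le_sub_one_of_pos (div_pos hw hp)
    rw [Real.log_div hw.ne' hp.ne', Real.log_div (Real.exp_pos _).ne' hZ.ne', Real.log_exp] at h
    have h2 := mul_le_mul_of_nonneg_left h (mul_pos hlam hp).le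
    have e1 : lam * p * (m / lam - Real.log Z - Real.log p)
        = (m - lam * Real.log p) * p - lam * Real.log Z * p := by
      field_simp
      ring
    have e2 : lam * p * (Real.exp (m / lam) / Z / p - 1)
        = lam * (Real.exp (m / lam) / Z - p) := by
      field_simp
    linarith

lemma aux_gibbs_sum {K : ℕ} (hK : 0 < K) (lam : ℝ) (hlam : 0 < lam) (m p : Fin K → ℝ)
    (hp : ∀ k, 0 ≤ p k) (h1 : ∑ k, p k = 1) :
    ∑ k, (m k - lam * Real.log (p k)) * p k ≤
      lam * Real.log (∑ k, Real.exp (m k / lam)) := by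
  have : Nonempty (Fin K) := ⟨⟨0, hK⟩⟩
  have hZ : 0 < ∑ k, Real.exp (m k / lam) :=
    Finset.sum_pos (fun k _ => Real.exp_pos _) Finset.univ_nonempty
  refine (Finset.sum_le_sum fun k _ => aux_gibbs lam _ (m k) (p k) hlam hZ (hp k)).trans ?_
  rw [Finset.sum_add_distrib, ← Finset.mul_sum, ← Finset.mul_sum, Finset.sum_sub_distrib, h1,
    ← Finset.sum_div, div_self hZ.ne']
  simp

theorem regularized_exact_optimal_value (K : ℕ) (hK : 0 < K)
    (lam : ℝ) (hlam : 0 < lam)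
    (α β : Fin K → ℝ) (t₀ : ℝ) (ht₀ : 0 ≤ t₀) (ht₁ : t₀ < 1)
    (π : ℝ → Fin K → ℝ) (s q : ℝ → Fin K → ℝ)
    (hπint : ∀ k, IntervalIntegrable (fun τ => π τ k) volume t₀ 1)
    (hπlogint : ∀ k, IntervalIntegrable (fun τ => π τ k * Real.log (π τ k)) volume t₀ 1)
    (hπ0 : ∀ τ ∈ Set.Icc t₀ 1, ∀ k, 0 ≤ π τ k)
    (hπ1 : ∀ τ ∈ Set.Icc t₀ 1, ∑ k, π τ k = 1)
    (hqβ : ∀ τ ∈ Set.Icc t₀ 1, ∀ k, 0 < q τ k + β k)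
    (hq : ∀ k, ∀ τ ∈ Set.Icc t₀ 1, HasDerivAt (fun t => q t k) (π τ k) τ)
    (hs : ∀ k, ∀ τ ∈ Set.Icc t₀ 1,
      HasDerivAt (fun t => s t k) ((s τ k + α k) / (q τ k + β k) * π τ k) τ)
    (πstar : Fin K → ℝ)
    (hπstar : πstar = fun k => Real.exp (((s t₀ k + α k) / (q t₀ k + β k)) / lam) /
      ∑ j, Real.exp (((s t₀ j + α j) / (q t₀ j + β j)) / lam)) :
    ((∫ τ in t₀..1, ∑ k,
        ((s τ k + α k) / (q τ k + β k) - lam * Real.log (π τ k)) * π τ k) ≤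
      (1 - t₀) * (lam * Real.log (∑ k,
        Real.exp (((s t₀ k + α k) / (q t₀ k + β k)) / lam)))) ∧
    ∃ s' q' : ℝ → Fin K → ℝ,
      s' t₀ = s t₀ ∧ q' t₀ = q t₀ ∧
      (∀ τ ∈ Set.Icc t₀ 1, ∀ k, 0 < q' τ k + β k) ∧
      (∀ k, ∀ τ ∈ Set.Icc t₀ 1, HasDerivAt (fun t => q' t k) (πstar k) τ) ∧
      (∀ k, ∀ τ ∈ Set.Icc t₀ 1,
        HasDerivAt (fun t => s' t k) ((s' τ k + α k) / (q' τ k + β k) * πstar k) τ) ∧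
      (∫ τ in t₀..1, ∑ k,
          ((s' τ k + α k) / (q' τ k + β k) - lam * Real.log (πstar k)) * πstar k) =
        (1 - t₀) * (lam * Real.log (∑ k,
          Real.exp (((s t₀ k + α k) / (q t₀ k + β k)) / lam))) := by
  have : Nonempty (Fin K) := ⟨⟨0, hK⟩⟩
  obtain ⟨m, hm⟩ : ∃ m : Fin K → ℝ, ∀ k, (s t₀ k + α k) / (q t₀ k + β k) = m k :=
    ⟨_, fun _ => rfl⟩
  have h0 : t₀ ∈ Set.Icc t₀ 1 := ⟨le_rfl, ht₁.le⟩
  simp only [hm] at hπstar ⊢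
  have hZ : 0 < ∑ k, Real.exp (m k / lam) :=
    Finset.sum_pos (fun k _ => Real.exp_pos _) Finset.univ_nonempty
  have hconst : ∀ k, ∀ τ ∈ Set.Icc t₀ 1, (s τ k + α k) / (q τ k + β k) = m k := by
    intro k
    have hd : ∀ τ ∈ Set.Icc t₀ 1,
        HasDerivAt (fun t => (s t k + α k) / (q t k + β k)) 0 τ := by
      intro τ hτ
      have hne := (hqβ τ hτ k).ne'
      have h := ((hs k τ hτ).add_const (α k)).div ((hq k τ hτ).add_const (β k)) hne
      rw [mul_right_comm, div_mul_cancel₀ _ hne, sub_self, zero_div] at h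
      exact h
    intro τ hτ
    rw [← hm k]
    exact constant_of_has_deriv_right_zero
      (fun x hx => (hd x hx).continuousAt.continuousWithinAt)
      (fun x hx => (hd x ⟨hx.1, hx.2.le⟩).hasDerivWithinAt) τ hτ
  refine ⟨?_, ?_⟩
  · have hc : (∫ τ in t₀..1, ∑ k,
        ((s τ k + α k) / (q τ k + β k) - lam * Real.log (π τ k)) * π τ k) =
        ∫ τ in t₀..1, ∑ k, (m k - lam * Real.log (π τ k)) * π τ k := by
      apply intervalIntegral.integral_congr
      intro τ hτ
      rw [Set.uIcc_of_le ht₁.le] at hτ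
      exact Finset.sum_congr rfl fun k _ => by rw [hconst k τ hτ]
    rw [hc]
    have hI : IntervalIntegrable
        (fun τ => ∑ k, (m k - lam * Real.log (π τ k)) * π τ k) volume t₀ 1 := by
      have h : IntervalIntegrable
          (∑ k, fun τ => (m k * π τ k - lam * (π τ k * Real.log (π τ k)))) volume t₀ 1 :=
        IntervalIntegrable.sum _ fun k _ =>
          ((hπint k).const_mul (m k)).sub ((hπlogint k).const_mul lam)
      convert h using 1
      ext τ
      rw [Finset.sum_apply]
      exact Finset.sum_congr rfl fun k _ => by ring
    have := intervalIntegral.integral_mono_on ht₁.le hI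
      (intervalIntegrable_const (c := lam * Real.log (∑ k, Real.exp (m k / lam))))
      (fun τ hτ => aux_gibbs_sum hK lam hlam m (π τ) (hπ0 τ hτ) (hπ1 τ hτ))
    rwa [intervalIntegral.integral_const, smul_eq_mul] at this
  · have hpos : ∀ k, 0 < πstar k := fun k => by
      rw [hπstar]; exact div_pos (Real.exp_pos _) hZ
    have hsum : ∑ k, πstar k = 1 := by
      rw [hπstar, ← Finset.sum_div, div_self hZ.ne']
    have hqp : ∀ τ ∈ Set.Icc t₀ 1, ∀ k, 0 < q t₀ k + πstar k * (τ - t₀) + β k := by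
      intro τ hτ k
      have h1 := hqβ t₀ h0 k
      have h2 := mul_nonneg (hpos k).le (sub_nonneg.2 hτ.1)
      linarith
    have hmu : ∀ τ ∈ Set.Icc t₀ 1, ∀ k,
        (s t₀ k + m k * πstar k * (τ - t₀) + α k) / (q t₀ k + πstar k * (τ - t₀) + β k)
          = m k := by
      intro τ hτ k
      rw [div_eq_iff (hqp τ hτ k).ne']
      have := (div_eq_iff (hqβ t₀ h0 k).ne').1 (hm k)
      linear_combination this
    have hlin : ∀ a c τ : ℝ, HasDerivAt (fun t => a + c * (t - t₀)) c τ := by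
      intro a c τ
      simpa using (((hasDerivAt_id τ).sub_const t₀).const_mul c).const_add a
    refine ⟨fun t k => s t₀ k + m k * πstar k * (t - t₀),
      fun t k => q t₀ k + πstar k * (t - t₀), ?_, ?_, hqp, ?_, ?_, ?_⟩
    · ext k; simp
    · ext k; simp
    · intro k τ _
      exact hlin _ _ _
    · intro k τ hτ
      simp only [hmu τ hτ k]
      exact hlin _ _ _
    · have hval : ∑ k, (m k - lam * Real.log (πstar k)) * πstar k
          = lam * Real.log (∑ k, Real.exp (m k / lam)) := by
        have : ∀ k, (m k - lam * Real.log (πstar k)) * πstar k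
            = lam * Real.log (∑ k, Real.exp (m k / lam)) * πstar k := by
          intro k
          congr 1
          rw [hπstar]
          simp only
          rw [Real.log_div (Real.exp_pos _).ne' hZ.ne', Real.log_exp]
          field_simp
          ring
        rw [Finset.sum_congr rfl fun k _ => this k, ← Finset.mul_sum, hsum, mul_one]
      have hc : (∫ τ in t₀..1, ∑ k,
          ((s t₀ k + m k * πstar k * (τ - t₀) + α k) / (q t₀ k + πstar k * (τ - t₀) + β k)
            - lam * Real.log (πstar k)) * πstar k) =
          ∫ τ in t₀..1, lam * Real.log (∑ k, Real.exp (m k / lam)) := by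
        apply intervalIntegral.integral_congr
        intro τ hτ
        rw [Set.uIcc_of_le ht₁.le] at hτ
        simp only [hmu τ hτ]
        exact hval
      rw [← smul_eq_mul (1 - t₀), ← intervalIntegral.integral_const]
      exact hc
end

section
/- Fix integers K ≥ 1 and n ≥ 1 and reals c₁, c₂ > 0. For s, q ∈ ℕ^K define p_k(s, q) = (c₁ n + s_k)/((c₁ + c₂) n + q_k), and define the Bayes value functions w^i : ℕ^K × ℕ^K → ℝ for i = 1, …, n+1 by backward induction: w^{n+1} ≡ 0 and w^i(s, q) = max_{1≤k≤K} [ p_k(s, q) · (1 + w^{i+1}(s + e_k, q + e_k)) + (1 − p_k(s, q)) · w^{i+1}(s, q + e_k) ], where e_k is the k-th standard basis vector. Separately, define the drift μ̂_k(ŝ, q̂) = (c₁ + ŝ_k)/(c₁ + c₂ + q̂_k) for ŝ, q̂ ∈ ℝ^K with nonnegative entries, and define the finite-difference scheme values ṽ^l for l = 0, …, n by ṽ^n ≡ 0 and ṽ^l(ŝ, q̂) = max_{1≤k≤K} [ ṽ^{l+1}(ŝ, q̂) + (1/n) · ( n μ̂_k(ŝ, q̂) (ṽ^{l+1}(ŝ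 + e_k/n, q̂ + e_k/n) − ṽ^{l+1}(ŝ, q̂ + e_k/n)) + n (ṽ^{l+1}(ŝ, q̂ + e_k/n) − ṽ^{l+1}(ŝ, q̂)) + μ̂_k(ŝ, q̂) ) ]. Then for every l ∈ {0, …, n} and every s, q ∈ ℕ^K: ṽ^l(s/n, q/n) = (1/n) · w^{l+1}(s, q). -/
theorem bernoulli_scheme_exact (K n : ℕ) (hK : 0 < K) (hn : 1 ≤ n)
    (c₁ c₂ : ℝ) (hc₁ : 0 < c₁) (hc₂ : 0 < c₂)
    (w : ℕ → (Fin K → ℕ) → (Fin K → ℕ) → ℝ)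
    (hw_end : ∀ s q, w (n + 1) s q = 0)
    (hw : ∀ i, 1 ≤ i → i ≤ n → ∀ s q : Fin K → ℕ,
      w i s q = Finset.univ.sup' (Finset.univ_nonempty_iff.mpr ⟨⟨0, hK⟩⟩) (fun k =>
        ((c₁ * n + s k) / ((c₁ + c₂) * n + q k)) *
            (1 + w (i + 1) (s + Pi.single k 1) (q + Pi.single k 1)) +
          (1 - (c₁ * n + s k) / ((c₁ + c₂) * n + q k)) * w (i + 1) s (q + Pi.single k 1)))
    (v : ℕ → (Fin K → ℝ) → (Fin K → ℝ) → ℝ)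
    (hv_end : ∀ sh qh, v n sh qh = 0)
    (hv : ∀ l, l < n → ∀ sh qh : Fin K → ℝ, (∀ k, 0 ≤ sh k) → (∀ k, 0 ≤ qh k) →
      v l sh qh = Finset.univ.sup' (Finset.univ_nonempty_iff.mpr ⟨⟨0, hK⟩⟩) (fun k =>
        v (l + 1) sh qh + (1 / (n : ℝ)) * (
          (n : ℝ) * ((c₁ + sh k) / (c₁ + c₂ + qh k)) *
              (v (l + 1) (sh + Pi.single k ((n : ℝ))⁻¹) (qh + Pi.single k ((n : ℝ))⁻¹) -
                v (l + 1) sh (qh + Pi.single k ((n : ℝ))⁻¹)) +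
            (n : ℝ) * (v (l + 1) sh (qh + Pi.single k ((n : ℝ))⁻¹) - v (l + 1) sh qh) +
            (c₁ + sh k) / (c₁ + c₂ + qh k)))) :
    ∀ l ≤ n, ∀ s q : Fin K → ℕ,
      v l (fun k => (s k : ℝ) / n) (fun k => (q k : ℝ) / n) =
        (1 / (n : ℝ)) * w (l + 1) s q := by
  have hn0 : (0 : ℝ) < n := by exact_mod_cast hn
  have hadd : ∀ (s : Fin K → ℕ) (k : Fin K),
      (fun j => (s j : ℝ) / n) + Pi.single k ((n : ℝ))⁻¹ =
        fun j => ((s + Pi.single k 1 : Fin K → ℕ) j : ℝ) / n := by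
    intro s k
    funext j
    by_cases h : j = k
    · subst h
      simp [add_div]
    · simp [h]
  have key : ∀ m l, l + m = n → ∀ s q : Fin K → ℕ,
      v l (fun k => (s k : ℝ) / n) (fun k => (q k : ℝ) / n) =
        (1 / (n : ℝ)) * w (l + 1) s q := by
    intro m
    induction m with
    | zero =>
      intro l hl s q
      have : l = n := by omega
      subst this
      rw [hv_end, hw_end, mul_zero]
    | succ m ih =>
      intro l hl s q
      have ih' := ih (l + 1) (by omega)
      rw [hv l (by omega) _ _ (fun k => by positivity) (fun k => by positivity),
        hw (l + 1) (by omega) (by omega),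
        Finset.comp_sup'_eq_sup'_comp (g := fun x : ℝ => (1 / (n : ℝ)) * x)
          (Finset.univ_nonempty_iff.mpr ⟨⟨0, hK⟩⟩)
          (fun x y => (mul_max_of_nonneg x y (by positivity)))]
      refine Finset.sup'_congr _ rfl (fun k _ => ?_)
      have hp : (c₁ + (s k : ℝ) / n) / (c₁ + c₂ + (q k : ℝ) / n) =
          (c₁ * n + s k) / ((c₁ + c₂) * n + q k) := by
        have h1 : (0 : ℝ) < (c₁ + c₂) * n + q k := by positivity
        have h2 : (0 : ℝ) < c₁ + c₂ + (q k : ℝ) / n := by positivity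
        rw [div_eq_div_iff h2.ne' h1.ne']
        field_simp
      simp only [Function.comp_apply]
      rw [hadd, hadd, ih', ih', ih', hp]
      generalize (c₁ * n + s k) / ((c₁ + c₂) * n + q k) = p
      field_simp
      ring
  intro l hl
  exact key (n - l) l (by omega)
end

section
/- Fix integers K ≥ 1 and n ≥ 1, a real γ > 0, and reals c₁, c₂ with α := c₁ n + c₂ √n > 0 and β := c₁ n − c₂ √n > 0. For s ∈ (γℤ)^K and q ∈ ℕ^K define P_k(s, q) = (α + s_k/(2γ) + q_k/2)/(α + β + q_k), and define the Bayes value functions w^i for i = 1, …, n+1 by backward induction: w^{n+1} ≡ 0 and w^i(s, q) = max_{1≤k≤K} [ γ(2 P_k(s, q) − 1) + P_k(s, q) · w^{i+1}(s + γ e_k, q + e_k) + (1 − P_k(s, q)) · w^{i+1}(s − γ e_k, q + e_k) ]. Separately, define the drift μ̂_k(ŝ, q̂) = (2γ c₂ + ŝ_k)/(2 c₁ + q̂_k), and the scheme values ṽ^l for l = 0, …, n by ṽ^n ≡ 0 and ṽ^l(ŝ, q̂) = max_{1≤k≤K} [ ṽ^{l+1}(ŝ, q̂) + (1/n) · ( (μ̂_k(ŝ,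 q̂) √n/(2γ)) (ṽ₊ − ṽ₋) + n (ṽ₀ − ṽ^{l+1}(ŝ, q̂)) + (n/2)(ṽ₊ − 2 ṽ₀ + ṽ₋) + μ̂_k(ŝ, q̂) ) ], where ṽ± = ṽ^{l+1}(ŝ ± (γ/√n) e_k, q̂ + e_k/n) and ṽ₀ = ṽ^{l+1}(ŝ, q̂ + e_k/n). Then for every l ∈ {0, …, n}, every s ∈ ℤ^K, and every q ∈ ℕ^K: ṽ^l(γ s/√n, q/n) = (1/√n) · w^{l+1}(γ s, q). -/
theorem binomial_scheme_exact (K n : ℕ) (hK : 0 < K) (hn : 1 ≤ n)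
    (γ : ℝ) (hγ : 0 < γ) (c₁ c₂ : ℝ)
    (hα : 0 < c₁ * n + c₂ * Real.sqrt n) (hβ : 0 < c₁ * n - c₂ * Real.sqrt n)
    (w : ℕ → (Fin K → ℤ) → (Fin K → ℕ) → ℝ)
    (hw_end : ∀ s q, w (n + 1) s q = 0)
    (hw : ∀ i, 1 ≤ i → i ≤ n → ∀ (s : Fin K → ℤ) (q : Fin K → ℕ),
      w i s q = Finset.univ.sup' (Finset.univ_nonempty_iff.mpr ⟨⟨0, hK⟩⟩) (fun k =>
        γ * (2 * (((c₁ * n + c₂ * Real.sqrt n) + (γ * (s k : ℝ)) / (2 * γ) + (q k : ℝ) / 2) /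
            ((c₁ * n + c₂ * Real.sqrt n) + (c₁ * n - c₂ * Real.sqrt n) + (q k : ℝ))) - 1) +
          (((c₁ * n + c₂ * Real.sqrt n) + (γ * (s k : ℝ)) / (2 * γ) + (q k : ℝ) / 2) /
              ((c₁ * n + c₂ * Real.sqrt n) + (c₁ * n - c₂ * Real.sqrt n) + (q k : ℝ))) *
            w (i + 1) (s + Pi.single k 1) (q + Pi.single k 1) +
          (1 - (((c₁ * n + c₂ * Real.sqrt n) + (γ * (s k : ℝ)) / (2 * γ) + (q k : ℝ) / 2) /
              ((c₁ * n + c₂ * Real.sqrt n) + (c₁ * n - c₂ * Real.sqrt n) + (q k : ℝ)))) *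
            w (i + 1) (s - Pi.single k 1) (q + Pi.single k 1)))
    (v : ℕ → (Fin K → ℝ) → (Fin K → ℝ) → ℝ)
    (hv_end : ∀ sh qh, v n sh qh = 0)
    (hv : ∀ l, l < n → ∀ sh qh : Fin K → ℝ, (∀ k, 0 ≤ qh k) →
      v l sh qh = Finset.univ.sup' (Finset.univ_nonempty_iff.mpr ⟨⟨0, hK⟩⟩) (fun k =>
        v (l + 1) sh qh + (1 / (n : ℝ)) * (
          ((2 * γ * c₂ + sh k) / (2 * c₁ + qh k)) * Real.sqrt n / (2 * γ) *
              (v (l + 1) (sh + Pi.single k (γ / Real.sqrt n)) (qh + Pi.single k ((n : ℝ))⁻¹) -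
                v (l + 1) (sh - Pi.single k (γ / Real.sqrt n)) (qh + Pi.single k ((n : ℝ))⁻¹)) +
            (n : ℝ) * (v (l + 1) sh (qh + Pi.single k ((n : ℝ))⁻¹) - v (l + 1) sh qh) +
            ((n : ℝ) / 2) *
              (v (l + 1) (sh + Pi.single k (γ / Real.sqrt n)) (qh + Pi.single k ((n : ℝ))⁻¹) -
                2 * v (l + 1) sh (qh + Pi.single k ((n : ℝ))⁻¹) +
                v (l + 1) (sh - Pi.single k (γ / Real.sqrt n)) (qh + Pi.single k ((n : ℝ))⁻¹)) +
            (2 * γ * c₂ + sh k) / (2 * c₁ + qh k)))) :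
    ∀ l ≤ n, ∀ (s : Fin K → ℤ) (q : Fin K → ℕ),
      v l (fun k => γ * (s k : ℝ) / Real.sqrt n) (fun k => (q k : ℝ) / n) =
        (1 / Real.sqrt n) * w (l + 1) s q := by
  intro l hl
  induction hl using Nat.decreasingInduction with
  | self => intro s q; rw [hv_end, hw_end, mul_zero]
  | of_succ l hl ih =>
    intro s q
    have hn0 : (0 : ℝ) < n := by exact_mod_cast hn
    have hr : 0 < Real.sqrt n := Real.sqrt_pos.mpr hn0
    have hr2 : Real.sqrt n * Real.sqrt n = n := Real.mul_self_sqrt hn0.le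
    rw [hv l hl _ _ (fun k => by positivity), hw (l + 1) (by omega) (by omega)]
    rw [Finset.apply_sup'_eq_sup'_comp _ (fun x : ℝ => 1 / Real.sqrt n * x)
      (fun x y => mul_max_of_nonneg x y (by positivity))]
    refine Finset.sup'_congr _ rfl (fun k _ => ?_)
    have e1 : (fun k => γ * (s k : ℝ) / Real.sqrt n) + Pi.single k (γ / Real.sqrt n)
        = fun j => γ * (((s + Pi.single k 1 : Fin K → ℤ) j : ℤ) : ℝ) / Real.sqrt n := by
      funext j
      rcases eq_or_ne j k with rfl | h
      · simp; ring
      · simp [h]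
    have e2 : (fun k => γ * (s k : ℝ) / Real.sqrt n) - Pi.single k (γ / Real.sqrt n)
        = fun j => γ * (((s - Pi.single k 1 : Fin K → ℤ) j : ℤ) : ℝ) / Real.sqrt n := by
      funext j
      rcases eq_or_ne j k with rfl | h
      · simp; ring
      · simp [h]
    have e3 : (fun k => (q k : ℝ) / n) + Pi.single k ((n : ℝ))⁻¹
        = fun j => (((q + Pi.single k 1 : Fin K → ℕ) j : ℕ) : ℝ) / n := by
      funext j
      rcases eq_or_ne j k with rfl | h
      · simp; ring
      · simp [h]
    rw [e1, e2, e3]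
    simp only [ih, Function.comp]
    generalize w (l + 1 + 1) (s + Pi.single k 1) (q + Pi.single k 1) = A
    generalize w (l + 1 + 1) (s - Pi.single k 1) (q + Pi.single k 1) = B
    generalize w (l + 1 + 1) s (q + Pi.single k 1) = C
    generalize w (l + 1 + 1) s q = D
    have hD : 0 < 2 * c₁ * n + (q k : ℝ) := by
      have : (0 : ℝ) ≤ q k := by positivity
      linarith
    generalize (q k : ℝ) = Q at *
    generalize (s k : ℝ) = S at *
    generalize Real.sqrt n = r at *
    have hmu : (2 * γ * c₂ + γ * S / r) / (2 * c₁ + Q / n)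
        = r * γ * ((2 * c₂ * r + S) / (2 * c₁ * n + Q)) := by
      have h1 : 2 * c₁ + Q / n = (2 * c₁ * n + Q) / n := by field_simp
      rw [h1, ← hr2]
      rw [← hr2] at hD
      have := hD.ne'
      field_simp
    have hP : ((c₁ * n + c₂ * r) + (γ * S) / (2 * γ) + Q / 2) /
        ((c₁ * n + c₂ * r) + (c₁ * n - c₂ * r) + Q)
        = (1 + (2 * c₂ * r + S) / (2 * c₁ * n + Q)) / 2 := by
      have h1 : (c₁ * n + c₂ * r) + (c₁ * n - c₂ * r) + Q = 2 * c₁ * n + Q := by ring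
      have h2 : γ * S / (2 * γ) = S / 2 := by field_simp
      rw [h1, h2, one_add_div hD.ne', div_div,
        div_eq_div_iff hD.ne' (mul_ne_zero hD.ne' two_ne_zero)]
      ring
    rw [hmu, hP]
    generalize (2 * c₂ * r + S) / (2 * c₁ * n + Q) = m
    rw [← hr2]
    field_simp
    ring
end
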